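/- There do not exist an open interval I ⊆ ℝ, smooth functions x, y, r : I → ℝ with r > 0 on I, and real numbers A₁, A₀, B₁, B₀ with A₁B₀ − B₁A₀ ≠ 0 such that on I: x'' = (A₁τ + A₀)·r², y'' = (B₁τ + B₀)·r², r'' = r, and x'² + y'² + r'² = r². -/

import Mathlib

open Set

lemma aux_zero {lo hi t f' : ℝ} {f : ℝ → ℝ} (h0 : ∀ τ ∈ Ioo lo hi, f τ = 0)
    (ht : t ∈ Ioo lo hi) (hf : HasDerivAt f f' t) : f' = 0 := by
  have h : f =ᶠ[nhds t] fun _ => (0:ℝ) := by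
    filter_upwards [isOpen_Ioo.mem_nhds ht] with τ hτ using h0 τ hτ
  exact hf.unique ((hasDerivAt_const t (0:ℝ)).congr_of_eventuallyEq h)

lemma aux_d {lo hi t : ℝ} {f : ℝ → ℝ} (hf : ContDiffOn ℝ (⊤ : ℕ∞) f (Ioo lo hi))
    (ht : t ∈ Ioo lo hi) :
    HasDerivAt f (deriv f t) t ∧ HasDerivAt (deriv f) (deriv (deriv f) t) t := by
  have h1 : ContDiffOn ℝ 1 (deriv f) (Ioo lo hi) :=
    hf.deriv_of_isOpen isOpen_Ioo (by norm_cast)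
  have hn := isOpen_Ioo.mem_nhds ht
  exact ⟨((hf.differentiableOn (by simp)).differentiableAt hn).hasDerivAt,
    ((h1.differentiableOn (by simp)).differentiableAt hn).hasDerivAt⟩

set_option maxHeartbeats 2000000 in
/-- Exclusion of Case (III): `c ≡ 0` and `det(P,Q) = A₁B₀ − B₁A₀ ≠ 0`
is impossible. -/
theorem case_III_cannot_occur :
    ¬ ∃ (lo hi : ℝ) (x y r : ℝ → ℝ) (A₁ A₀ B₁ B₀ : ℝ),
      lo < hi ∧
      ContDiffOn ℝ (⊤ : ℕ∞) x (Ioo lo hi) ∧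
      ContDiffOn ℝ (⊤ : ℕ∞) y (Ioo lo hi) ∧
      ContDiffOn ℝ (⊤ : ℕ∞) r (Ioo lo hi) ∧
      (∀ τ ∈ Ioo lo hi, 0 < r τ) ∧
      A₁ * B₀ - B₁ * A₀ ≠ 0 ∧
      (∀ τ ∈ Ioo lo hi, deriv (deriv x) τ = (A₁ * τ + A₀) * r τ ^ 2) ∧
      (∀ τ ∈ Ioo lo hi, deriv (deriv y) τ = (B₁ * τ + B₀) * r τ ^ 2) ∧
      (∀ τ ∈ Ioo lo hi, deriv (deriv r) τ = r τ) ∧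
      (∀ τ ∈ Ioo lo hi,
        deriv x τ ^ 2 + deriv y τ ^ 2 + deriv r τ ^ 2 = r τ ^ 2) := by
  rintro ⟨lo, hi, x, y, r, A₁, A₀, B₁, B₀, hlt, hx, hy, hr, hpos, hD, ex, ey, er, eE⟩
  have ha : ∀ t : ℝ, HasDerivAt (fun τ => A₁ * τ + A₀) A₁ t := fun t => by
    simpa using ((hasDerivAt_id t).const_mul A₁).add_const A₀
  have hb : ∀ t : ℝ, HasDerivAt (fun τ => B₁ * τ + B₀) B₁ t := fun t => by
    simpa using ((hasDerivAt_id t).const_mul B₁).add_const B₀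
  have F2 : ∀ t ∈ Ioo lo hi, (fun τ => deriv x τ * (A₁ * τ + A₀) + deriv y τ * (B₁ * τ + B₀)) t = 0 := by
    intro t ht
    have h := aux_zero (f := fun τ => deriv x τ ^ 2 + deriv y τ ^ 2 + deriv r τ ^ 2 - r τ ^ 2)
      (fun τ hτ => sub_eq_zero.2 (eE τ hτ)) ht
      (((((aux_d hx ht).2.fun_pow 2).fun_add ((aux_d hy ht).2.fun_pow 2)).fun_add
        ((aux_d hr ht).2.fun_pow 2)).fun_sub ((aux_d hr ht).1.fun_pow 2))
    rw [ex t ht, ey t ht, er t ht] at h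
    norm_num at h
    have h2 : (2 * r t ^ 2) ≠ 0 := by have := hpos t ht; positivity
    apply mul_left_cancel₀ h2
    linear_combination h
  have F3 : ∀ t ∈ Ioo lo hi, (fun τ => deriv x τ * A₁ + deriv y τ * B₁ +
      r τ ^ 2 * ((A₁ * τ + A₀) ^ 2 + (B₁ * τ + B₀) ^ 2)) t = 0 := by
    intro t ht
    have h := aux_zero F2 ht
      (((aux_d hx ht).2.fun_mul (ha t)).fun_add ((aux_d hy ht).2.fun_mul (hb t)))
    rw [ex t ht, ey t ht] at h
    linear_combination h
  have F4 : ∀ t ∈ Ioo lo hi, (fun τ => 3 * (r τ * ((A₁ * τ + A₀) * A₁ + (B₁ * τ + B₀) * B₁)) +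
      2 * (deriv r τ * ((A₁ * τ + A₀) ^ 2 + (B₁ * τ + B₀) ^ 2))) t = 0 := by
    intro t ht
    have h := aux_zero F3 ht
      ((((aux_d hx ht).2.mul_const A₁).fun_add ((aux_d hy ht).2.mul_const B₁)).fun_add
        (((aux_d hr ht).1.fun_pow 2).fun_mul (((ha t).fun_pow 2).fun_add ((hb t).fun_pow 2))))
    rw [ex t ht, ey t ht] at h
    norm_num at h
    apply mul_left_cancel₀ (hpos t ht).ne'
    linear_combination h
  have F5 : ∀ t ∈ Ioo lo hi, 4 * ((A₁ * t + A₀) ^ 2 + (B₁ * t + B₀) ^ 2) ^ 2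
      + 6 * (A₁ ^ 2 + B₁ ^ 2) * ((A₁ * t + A₀) ^ 2 + (B₁ * t + B₀) ^ 2)
      - 21 * ((A₁ * t + A₀) * A₁ + (B₁ * t + B₀) * B₁) ^ 2 = 0 := by
    intro t ht
    have h := aux_zero F4 ht
      ((((aux_d hr ht).1.fun_mul (((ha t).mul_const A₁).fun_add ((hb t).mul_const B₁))).const_mul 3).fun_add
       (((aux_d hr ht).2.fun_mul (((ha t).fun_pow 2).fun_add ((hb t).fun_pow 2))).const_mul 2))
    rw [er t ht] at h
    norm_num at h
    have h4 := F4 t ht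
    simp only at h4
    apply mul_left_cancel₀ (hpos t ht).ne'
    linear_combination 2 * ((A₁ * t + A₀) ^ 2 + (B₁ * t + B₀) ^ 2) * h
      - 7 * ((A₁ * t + A₀) * A₁ + (B₁ * t + B₀) * B₁) * h4
  obtain ⟨m, d, hd, hm⟩ : ∃ m d : ℝ, 0 < d ∧ ∀ k : ℝ, 0 ≤ k → k ≤ 4 → m + k * d ∈ Ioo lo hi := by
    refine ⟨lo + (hi - lo) / 6, (hi - lo) / 6, by linarith, fun k h0 h4 => ⟨?_, ?_⟩⟩ <;> nlinarith
  have g0 := F5 _ (hm 0 (by norm_num) (by norm_num))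
  have g1 := F5 _ (hm 1 (by norm_num) (by norm_num))
  have g2 := F5 _ (hm 2 (by norm_num) (by norm_num))
  have g3 := F5 _ (hm 3 (by norm_num) (by norm_num))
  have g4 := F5 _ (hm 4 (by norm_num) (by norm_num))
  have key : (96 * d ^ 4) * (A₁ ^ 2 + B₁ ^ 2) ^ 2 = 0 := by
    linear_combination g0 - 4 * g1 + 6 * g2 - 4 * g3 + g4
  have hp : A₁ ^ 2 + B₁ ^ 2 = 0 := by
    rcases mul_eq_zero.1 key with h | h
    · exact absurd h (by positivity)
    · exact pow_eq_zero_iff (two_ne_zero) |>.1 h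
  have hA : A₁ = 0 := pow_eq_zero_iff two_ne_zero |>.1 (by linarith [sq_nonneg A₁, sq_nonneg B₁] : A₁ ^ 2 = 0)
  have hB : B₁ = 0 := pow_eq_zero_iff two_ne_zero |>.1 (by linarith [sq_nonneg A₁, sq_nonneg B₁] : B₁ ^ 2 = 0)
  exact hD (by rw [hA, hB]; ring)
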